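/- Weak maximum principle for parabolic equations, c ≤ 0: Let Ω ⊆ E = EuclideanSpace ℝ (Fin n) be a nonempty bounded open set, T > 0, and let u : ℝ × E → ℝ be admissible on Ω_T = Ω × (0,T] with data (∂ₜu, Du, D²u). Assume the coefficients a, b, c are bounded on (0,T] × Ω with c(t,x) ≤ 0 there, and the operator is parabolic with constant λ > 0. If A(u)(t,x) − ∂ₜu(t,x) ≥ 0 for all t ∈ (0,T] and x ∈ Ω, then writing u⁺ = max(u, 0), for every t ∈ [0,T] and x in the closure of Ω one has u(t,x) ≤ sSup of u⁺ over the parabolic boundary ∂ₚΩ_T = ([0,T] × frontier Ω) ∪ ({0} × closure Ω). -/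

import Mathlib

open Set

open scoped MatrixOrder Matrix.Norms.L2Operator Topology in
lemma wmp_psd_factor {n : ℕ} (H : Matrix (Fin n) (Fin n) ℝ) (hH : H.PosSemidef) :
    ∃ B : Matrix (Fin n) (Fin n) ℝ, ∀ i j, H i j = ∑ k, B k i * B k j := by
  obtain ⟨B, hB⟩ := CStarAlgebra.nonneg_iff_eq_star_mul_self.mp hH.nonneg
  refine ⟨B, fun i j => ?_⟩
  rw [hB]
  simp [Matrix.mul_apply, Matrix.star_apply]

lemma wmp_trace {n : ℕ} (A : Fin n → Fin n → ℝ)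
    (hA : ∀ ξ : EuclideanSpace ℝ (Fin n), 0 ≤ ∑ i, ∑ j, A i j * ξ i * ξ j)
    (Q : EuclideanSpace ℝ (Fin n) →L[ℝ] (EuclideanSpace ℝ (Fin n) →L[ℝ] ℝ))
    (hs : ∀ v w, Q v w = Q w v) (hQ : ∀ v, Q v v ≤ 0) :
    ∑ i, ∑ j, A i j * Q (EuclideanSpace.single i 1) (EuclideanSpace.single j 1) ≤ 0 := by
  have hpsd : (Matrix.of fun i j => - Q (EuclideanSpace.single i 1)
      (EuclideanSpace.single j 1)).PosSemidef := by
    refine Matrix.PosSemidef.of_dotProduct_mulVec_nonneg ?_ ?_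
    · ext i j
      simp [Matrix.conjTranspose_apply, hs]
    · intro x
      have h := hQ (∑ i, x i • EuclideanSpace.single i (1:ℝ))
      simp only [map_sum, map_smul, ContinuousLinearMap.sum_apply, ContinuousLinearMap.smul_apply,
        smul_eq_mul] at h
      have h2 : star x ⬝ᵥ ((Matrix.of fun i j => - Q (EuclideanSpace.single i 1)
          (EuclideanSpace.single j 1)).mulVec x) = - ∑ i, x i * ∑ j, x j *
            Q (EuclideanSpace.single j 1) (EuclideanSpace.single i 1) := by
        simp only [dotProduct, Matrix.mulVec, Matrix.of_apply, ← Finset.sum_neg_distrib]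
        refine Finset.sum_congr rfl fun i _ => ?_
        simp only [Pi.star_apply, star_trivial, neg_mul, Finset.sum_neg_distrib, mul_neg]
        congr 2
        refine Finset.sum_congr rfl fun j _ => ?_
        rw [hs]; ring
      rw [h2]
      linarith
  obtain ⟨B, hB⟩ := wmp_psd_factor _ hpsd
  have h1 : ∑ i, ∑ j, A i j * Q (EuclideanSpace.single i 1) (EuclideanSpace.single j 1)
      = - ∑ k, ∑ i, ∑ j, A i j * B k i * B k j := by
    have hc : ∑ k, ∑ i, ∑ j, A i j * B k i * B k j = ∑ i, ∑ k, ∑ j, A i j * B k i * B k j :=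
      Finset.sum_comm
    rw [hc, ← Finset.sum_neg_distrib]
    refine Finset.sum_congr rfl fun i _ => ?_
    have hc : ∑ k, ∑ j, A i j * B k i * B k j = ∑ j, ∑ k, A i j * B k i * B k j :=
      Finset.sum_comm
    rw [hc, ← Finset.sum_neg_distrib]
    refine Finset.sum_congr rfl fun j _ => ?_
    have := hB i j
    simp only [Matrix.of_apply] at this
    rw [show Q (EuclideanSpace.single i 1) (EuclideanSpace.single j 1) = - ∑ k, B k i * B k j by
      linarith, mul_neg, Finset.mul_sum]
    simp only [mul_assoc]
  rw [h1]
  have : 0 ≤ ∑ k, ∑ i, ∑ j, A i j * B k i * B k j :=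
    Finset.sum_nonneg fun k _ => by simpa using hA (WithLp.toLp 2 (B k))
  linarith

open Topology in
lemma wmp_second {E : Type*} [NormedAddCommGroup E] [NormedSpace ℝ E] (f : E → ℝ)
    (D : E → E →L[ℝ] ℝ) (Q : E →L[ℝ] (E →L[ℝ] ℝ)) (x : E)
    (hf : ∀ᶠ y in 𝓝 x, HasFDerivAt f (D y) y) (hD : HasFDerivAt D Q x)
    (hmax : IsLocalMax f x) (v : E) : Q v v ≤ 0 := by
  by_contra! hpos
  let l : ℝ → E := fun s => x + s • v
  have hl : ∀ s, HasDerivAt l v s := fun s => by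
    have h := ((hasDerivAt_id s).smul_const v).const_add x
    rw [one_smul] at h
    exact h
  have hl0 : l 0 = x := by simp [l]
  have htend : Filter.Tendsto l (𝓝 0) (𝓝 x) := by
    have := (hl 0).continuousAt.tendsto
    rwa [hl0] at this
  have h1 : ∀ᶠ s in 𝓝 (0:ℝ), HasDerivAt (f ∘ l) (D (l s) v) s := by
    filter_upwards [htend.eventually hf] with s hs
    exact hs.comp_hasDerivAt s (hl s)
  have h2 : HasDerivAt (fun s => D (l s) v) (Q v v) 0 := by
    have hD' : HasFDerivAt D Q (l 0) := by rwa [hl0]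
    have := hD'.comp_hasDerivAt 0 (hl 0)
    simpa using this.clm_apply (hasDerivAt_const (0:ℝ) v)
  have h3 : deriv (f ∘ l) =ᶠ[𝓝 0] fun s => D (l s) v := h1.mono fun s hs => hs.deriv
  have h4 : deriv (deriv (f ∘ l)) 0 = Q v v := by
    rw [h3.deriv_eq]; exact h2.deriv
  have hmax' : IsLocalMax (f ∘ l) 0 := by
    have := htend.eventually hmax
    filter_upwards [this] with s hs
    simpa [hl0] using hs
  have hmin : IsLocalMin (f ∘ l) 0 :=
    isLocalMin_of_deriv_deriv_pos (by rw [h4]; exact hpos) hmax'.deriv_eq_zero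
      h1.self_of_nhds.continuousAt
  have hc : (f ∘ l) =ᶠ[𝓝 0] fun _ => (f ∘ l) 0 := by
    filter_upwards [hmax', hmin] with s a b using le_antisymm a b
  have h5 := hc.deriv.deriv_eq
  rw [h4] at h5
  simp at h5
  linarith

/-- Weak maximum principle for parabolic equations, `c ≤ 0`: if
`A(u) - ∂ₜu ≥ 0` on the parabolic cylinder `Ω × (0,T]`, where
`A(u) = ∑ aᵢⱼ ∂ᵢ∂ⱼu + ∑ bᵢ ∂ᵢu + c·u` is parabolic with bounded coefficients
and `c ≤ 0`, and `u` is admissible, then for all `t ∈ [0,T]` and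
`x ∈ closure Ω`, `u(t,x)` is at most the supremum of `u⁺ = max(u,0)` over the
parabolic boundary `∂ₚΩ_T = ([0,T] × ∂Ω) ∪ ({0} × closure Ω)`. -/
theorem weak_maximum_principle_parabolic_c_nonpos (n : ℕ)
    (Ω : Set (EuclideanSpace ℝ (Fin n)))
    (hΩne : Ω.Nonempty) (hΩopen : IsOpen Ω) (hΩbd : Bornology.IsBounded Ω)
    (T : ℝ) (hT : 0 < T)
    (u : ℝ × EuclideanSpace ℝ (Fin n) → ℝ)
    (ut : ℝ × EuclideanSpace ℝ (Fin n) → ℝ)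
    (Du : ℝ × EuclideanSpace ℝ (Fin n) → (EuclideanSpace ℝ (Fin n) →L[ℝ] ℝ))
    (D2u : ℝ × EuclideanSpace ℝ (Fin n) →
      (EuclideanSpace ℝ (Fin n) →L[ℝ] (EuclideanSpace ℝ (Fin n) →L[ℝ] ℝ)))
    (hu_cont : ContinuousOn u (Set.Icc 0 T ×ˢ closure Ω))
    (hut : ∀ t ∈ Set.Ioc 0 T, ∀ x ∈ Ω,
      HasDerivWithinAt (fun s => u (s, x)) (ut (t, x)) (Set.Ioc 0 T) t)
    (hDu : ∀ t ∈ Set.Ioc 0 T, ∀ x ∈ Ω,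
      HasFDerivAt (fun y => u (t, y)) (Du (t, x)) x)
    (hD2u : ∀ t ∈ Set.Ioc 0 T, ∀ x ∈ Ω,
      HasFDerivAt (fun y => Du (t, y)) (D2u (t, x)) x)
    (a : Fin n → Fin n → ℝ × EuclideanSpace ℝ (Fin n) → ℝ)
    (b : Fin n → ℝ × EuclideanSpace ℝ (Fin n) → ℝ)
    (c : ℝ × EuclideanSpace ℝ (Fin n) → ℝ)
    (K : ℝ) (hK : 0 < K)
    (ha_bd : ∀ i j, ∀ t ∈ Set.Ioc 0 T, ∀ x ∈ Ω, |a i j (t, x)| ≤ K)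
    (hb_bd : ∀ i, ∀ t ∈ Set.Ioc 0 T, ∀ x ∈ Ω, |b i (t, x)| ≤ K)
    (hc_bd : ∀ t ∈ Set.Ioc 0 T, ∀ x ∈ Ω, |c (t, x)| ≤ K)
    (hc_nonpos : ∀ t ∈ Set.Ioc 0 T, ∀ x ∈ Ω, c (t, x) ≤ 0)
    (lam : ℝ) (hlam : 0 < lam)
    (hpar : ∀ t ∈ Set.Ioc 0 T, ∀ x ∈ Ω, ∀ ξ : EuclideanSpace ℝ (Fin n),
      lam * ‖ξ‖ ^ 2 ≤ ∑ i, ∑ j, a i j (t, x) * ξ i * ξ j)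
    (hLu : ∀ t ∈ Set.Ioc 0 T, ∀ x ∈ Ω,
      0 ≤ (∑ i, ∑ j, a i j (t, x) *
            D2u (t, x) (EuclideanSpace.single i 1) (EuclideanSpace.single j 1)) +
          (∑ i, b i (t, x) * Du (t, x) (EuclideanSpace.single i 1)) +
          c (t, x) * u (t, x) - ut (t, x)) :
    ∀ t ∈ Set.Icc (0 : ℝ) T, ∀ x ∈ closure Ω,
      u (t, x) ≤
        sSup ((fun p => max (u p) 0) ''
          ((Set.Icc 0 T ×ˢ frontier Ω) ∪ ({0} ×ˢ closure Ω))) := by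
  intro t0 ht0 x0 hx0
  set S := (Set.Icc 0 T ×ˢ frontier Ω) ∪ (({0} : Set ℝ) ×ˢ closure Ω) with hS
  have hcpt : IsCompact (Set.Icc 0 T ×ˢ closure Ω) := isCompact_Icc.prod hΩbd.isCompact_closure
  have hsub : S ⊆ Set.Icc 0 T ×ˢ closure Ω := by
    rintro ⟨s, y⟩ (⟨h1, h2⟩ | ⟨h1, h2⟩)
    · exact ⟨h1, frontier_subset_closure h2⟩
    · refine ⟨?_, h2⟩
      have h1' : s = 0 := h1
      simp [h1', hT.le]
  have hbdd : BddAbove ((fun p => max (u p) 0) '' S) :=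
    (hcpt.bddAbove_image (hu_cont.sup continuousOn_const)).mono (image_mono hsub)
  have hle : ∀ p ∈ S, max (u p) 0 ≤ sSup ((fun p => max (u p) 0) '' S) :=
    fun p hp => le_csSup hbdd ⟨p, hp, rfl⟩
  set M := sSup ((fun p => max (u p) 0) '' S) with hM
  have hM0 : 0 ≤ M := by
    obtain ⟨y, hy⟩ := hΩne
    exact (le_max_right _ _).trans (hle (0, y) (Or.inr ⟨rfl, subset_closure hy⟩))
  by_contra! hlt
  obtain ⟨ε, hε, hεT⟩ : ∃ ε : ℝ, 0 < ε ∧ ε * T < u (t0, x0) - M := by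
    refine ⟨(u (t0, x0) - M) / (2 * T), by have := sub_pos.2 hlt; positivity, ?_⟩
    have : (u (t0, x0) - M) / (2 * T) * T = (u (t0, x0) - M) / 2 := by field_simp
    linarith
  obtain ⟨⟨t, x⟩, ⟨ht, hx⟩, hmax⟩ := hcpt.exists_isMaxOn ⟨(t0, x0), ht0, hx0⟩
    (f := fun p => u p - ε * p.1) (hu_cont.sub (by fun_prop))
  simp only at ht hx
  have hmax' : ∀ s ∈ Set.Icc 0 T, ∀ y ∈ closure Ω, u (s, y) - ε * s ≤ u (t, x) - ε * t :=
    fun s hs y hy => hmax (a := (s, y)) ⟨hs, hy⟩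
  have hbig : M < u (t, x) := by
    have h1 := hmax' t0 ht0 x0 hx0
    have h2 : ε * t0 ≤ ε * T := mul_le_mul_of_nonneg_left ht0.2 hε.le
    have h3 : 0 ≤ ε * t := mul_nonneg hε.le ht.1
    linarith
  have hnS : (t, x) ∉ S := fun h => absurd ((le_max_left _ _).trans (hle _ h)) (not_le.2 hbig)
  have htpos : 0 < t := by
    refine lt_of_le_of_ne ht.1 fun h => hnS (Or.inr ⟨?_, hx⟩)
    simp [← h]
  have hxΩ : x ∈ Ω := by
    by_contra hn
    refine hnS (Or.inl ⟨ht, ?_⟩)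
    rw [hΩopen.frontier_eq]
    exact ⟨hx, hn⟩
  have htI : t ∈ Set.Ioc 0 T := ⟨htpos, ht.2⟩
  have hnhds := hΩopen.mem_nhds hxΩ
  have hlm : IsLocalMax (fun y => u (t, y)) x := by
    filter_upwards [hnhds] with y hy
    have := hmax' t ht y (subset_closure hy)
    linarith
  have hD0 : Du (t, x) = 0 := hlm.hasFDerivAt_eq_zero (hDu t htI x hxΩ)
  have hev : ∀ᶠ y in nhds x, HasFDerivAt (fun y => u (t, y)) (Du (t, y)) y := by
    filter_upwards [hnhds] with y hy using hDu t htI y hy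
  have hD2 := hD2u t htI x hxΩ
  have hQ := wmp_second _ _ _ x hev hD2 hlm
  have hs := second_derivative_symmetric_of_eventually hev hD2
  have htr := wmp_trace (fun i j => a i j (t, x))
    (fun ξ => le_trans (by positivity) (hpar t htI x hxΩ ξ)) _ hs hQ
  have htime : ε ≤ ut (t, x) := by
    have hd : HasDerivWithinAt (fun s => u (s, x) - ε * s) (ut (t, x) - ε) (Set.Ioc 0 T) t := by
      have h := (hut t htI x hxΩ).sub ((hasDerivWithinAt_id t (Set.Ioc 0 T)).const_mul ε)
      rw [mul_one] at h
      exact h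
    have hmo : IsMaxOn (fun s => u (s, x) - ε * s) (Set.Ioc 0 T) t :=
      fun s hs => hmax' s ⟨hs.1.le, hs.2⟩ x hx
    have hc : t / 2 - t ∈ posTangentConeAt (Set.Ioc 0 T) t := by
      refine sub_mem_posTangentConeAt_of_segment_subset ?_
      exact (convex_Ioc 0 T).segment_subset htI ⟨by linarith, by linarith [ht.2]⟩
    have := hmo.localize.hasFDerivWithinAt_nonpos hd.hasFDerivWithinAt hc
    simp at this
    nlinarith
  have hL := hLu t htI x hxΩ
  have hcu : c (t, x) * u (t, x) ≤ 0 :=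
    mul_nonpos_of_nonpos_of_nonneg (hc_nonpos t htI x hxΩ) (by linarith)
  simp only [hD0, ContinuousLinearMap.zero_apply, mul_zero, Finset.sum_const_zero] at hL
  linarith
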